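/- Let C₁, C₂ be real constants with C₁ > C₂. Then there exists A₀ ≥ 2 such that for every A ≥ A₀, the integral ∫_0^T (−C₁ sin t − C₂ cos t)/(A + sin t − cos t) dt tends to +∞ as T → ∞. In particular (substituting t = −log r) ∫_ε^{1/2} g(r)/r dr → +∞ as ε → 0⁺, where g(r) = (−C₁ sin(−log r) − C₂ cos(−log r))/(A + sin(−log r) − cos(−log r)). -/

import Mathlib

open Set Filter

theorem abs_sin_sub_cos_le (t : ℝ) : |Real.sin t - Real.cos t| ≤ 3 / 2 := by
  apply abs_le_of_sq_le_sq _ (by norm_num)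
  nlinarith [Real.sin_sq_add_cos_sq t, sq_nonneg (Real.sin t + Real.cos t)]

theorem add_sin_sub_cos_pos {A : ℝ} (hA : 2 ≤ A) (t : ℝ) :
    0 < A + Real.sin t - Real.cos t := by
  linarith [(abs_le.mp (abs_sin_sub_cos_le t)).1]

theorem continuous_trig_quotient (C₁ C₂ : ℝ) {A : ℝ} (hA : 2 ≤ A) :
    Continuous fun t : ℝ =>
      (-C₁ * Real.sin t - C₂ * Real.cos t) / (A + Real.sin t - Real.cos t) :=
  Continuous.div (by fun_prop) (by fun_prop) fun t => (add_sin_sub_cos_pos hA t).ne'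

/-- The derivative of this function is a lower bound for the trigonometric quotient. -/
noncomputable def quotientMinorantPrimitive (C₁ C₂ A t : ℝ) : ℝ :=
  -((C₁ + C₂) / 2) * Real.log (A + Real.sin t - Real.cos t) +
    (C₁ - C₂) / 2 * ((Real.cos t + Real.sin t) / A + (t - Real.sin t ^ 2) / (A * (A + 2)))

/-- The derivative of `quotientMinorantPrimitive`. -/
noncomputable def quotientMinorant (C₁ C₂ A t : ℝ) : ℝ :=
  -((C₁ + C₂) / 2) * ((Real.cos t + Real.sin t) / (A + Real.sin t - Real.cos t)) +
    (C₁ - C₂) / 2 * ((Real.cos t - Real.sin t) / A +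
      (1 - 2 * Real.sin t * Real.cos t) / (A * (A + 2)))

theorem hasDerivAt_quotientMinorantPrimitive (C₁ C₂ : ℝ) {A : ℝ} (hA : 2 ≤ A) (t : ℝ) :
    HasDerivAt (quotientMinorantPrimitive C₁ C₂ A) (quotientMinorant C₁ C₂ A t) t := by
  have hs := Real.hasDerivAt_sin t
  have hc := Real.hasDerivAt_cos t
  have hlog := ((hs.const_add A).sub hc).log (add_sin_sub_cos_pos hA t).ne'
  have hlin := (hc.add hs).div_const A
  have hsq := ((hasDerivAt_id t).sub (hs.pow 2)).div_const (A * (A + 2))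
  refine ((hlog.const_mul (-((C₁ + C₂) / 2))).add
    ((hlin.add hsq).const_mul ((C₁ - C₂) / 2))).congr_deriv ?_
  simp only [quotientMinorant, Pi.sub_apply]
  push_cast
  ring

theorem continuous_quotientMinorant (C₁ C₂ : ℝ) {A : ℝ} (hA : 2 ≤ A) :
    Continuous (quotientMinorant C₁ C₂ A) := by
  have hquot : Continuous fun t : ℝ =>
      (Real.cos t + Real.sin t) / (A + Real.sin t - Real.cos t) :=
    Continuous.div (by fun_prop) (by fun_prop) fun t => (add_sin_sub_cos_pos hA t).ne'
  unfold quotientMinorant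
  fun_prop

theorem quotientMinorant_le {C₁ C₂ A : ℝ} (h : C₂ ≤ C₁) (hA : 2 ≤ A) (t : ℝ) :
    quotientMinorant C₁ C₂ A t ≤
      (-C₁ * Real.sin t - C₂ * Real.cos t) / (A + Real.sin t - Real.cos t) := by
  have hD := add_sin_sub_cos_pos hA t
  have hA0 : 0 < A := by linarith
  have hs := (abs_le.mp (abs_sin_sub_cos_le t)).2
  have hsq : 1 - 2 * Real.sin t * Real.cos t = (Real.sin t - Real.cos t) ^ 2 := by
    linear_combination -Real.sin_sq_add_cos_sq t
  have hident : (-C₁ * Real.sin t - C₂ * Real.cos t) / (A + Real.sin t - Real.cos t) =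
      -((C₁ + C₂) / 2) * ((Real.cos t + Real.sin t) / (A + Real.sin t - Real.cos t)) +
        (C₁ - C₂) / 2 * ((Real.cos t - Real.sin t) / A +
          (Real.sin t - Real.cos t) ^ 2 / (A * (A + Real.sin t - Real.cos t))) := by
    field_simp
    ring
  rw [hident, quotientMinorant, hsq]
  have hc : 0 ≤ (C₁ - C₂) / 2 := by linarith
  gcongr
  linarith

theorem exists_le_quotientMinorantPrimitive {C₁ C₂ A : ℝ} (h : C₂ ≤ C₁) (hA : 2 ≤ A) :
    ∃ M : ℝ, ∀ t : ℝ,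
      (C₁ - C₂) / 2 / (A * (A + 2)) * t - M ≤ quotientMinorantPrimitive C₁ C₂ A t := by
  have hA0 : 0 < A := by linarith
  refine ⟨|(C₁ + C₂) / 2| * (|Real.log (A - 3 / 2)| + |Real.log (A + 3 / 2)|) +
    (C₁ - C₂) / 2 * (2 / A + 1 / (A * (A + 2))), fun t => ?_⟩
  have hs := abs_le.mp (abs_sin_sub_cos_le t)
  have hD := add_sin_sub_cos_pos hA t
  have hlog : |Real.log (A + Real.sin t - Real.cos t)| ≤
      |Real.log (A - 3 / 2)| + |Real.log (A + 3 / 2)| := by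
    have hlower := Real.log_le_log (by linarith : 0 < A - 3 / 2)
      (by linarith : A - 3 / 2 ≤ A + Real.sin t - Real.cos t)
    have hupper := Real.log_le_log hD
      (by linarith : A + Real.sin t - Real.cos t ≤ A + 3 / 2)
    rw [abs_le]
    constructor
    · linarith [neg_abs_le (Real.log (A - 3 / 2)), abs_nonneg (Real.log (A + 3 / 2))]
    · linarith [le_abs_self (Real.log (A + 3 / 2)), abs_nonneg (Real.log (A - 3 / 2))]
  have hprod : -(|(C₁ + C₂) / 2| * (|Real.log (A - 3 / 2)| + |Real.log (A + 3 / 2)|)) ≤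
      -((C₁ + C₂) / 2) * Real.log (A + Real.sin t - Real.cos t) := by
    have hle := mul_le_mul_of_nonneg_left hlog (abs_nonneg ((C₁ + C₂) / 2))
    rw [← abs_mul] at hle
    linarith [le_abs_self ((C₁ + C₂) / 2 * Real.log (A + Real.sin t - Real.cos t))]
  have htrig : (-2) / A + (t - 1) / (A * (A + 2)) ≤
      (Real.cos t + Real.sin t) / A + (t - Real.sin t ^ 2) / (A * (A + 2)) := by
    have hcos := Real.neg_one_le_cos t
    have hsin := Real.neg_one_le_sin t
    have hsin_sq := Real.sin_sq_le_one t
    gcongr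
    linarith
  have hc : 0 ≤ (C₁ - C₂) / 2 := by linarith
  have hmul := mul_le_mul_of_nonneg_left htrig hc
  have hexp : (C₁ - C₂) / 2 / (A * (A + 2)) * t -
      (C₁ - C₂) / 2 * (2 / A + 1 / (A * (A + 2))) =
      (C₁ - C₂) / 2 * ((-2) / A + (t - 1) / (A * (A + 2))) := by ring
  rw [quotientMinorantPrimitive]
  linarith

theorem tendsto_integral_trig_quotient {C₁ C₂ A : ℝ} (h : C₂ < C₁) (hA : 2 ≤ A) :
    Tendsto
      (fun T => ∫ t in (0:ℝ)..T,
        (-C₁ * Real.sin t - C₂ * Real.cos t) / (A + Real.sin t - Real.cos t))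
      atTop atTop := by
  obtain ⟨M, hM⟩ := exists_le_quotientMinorantPrimitive h.le hA
  have hslope : 0 < (C₁ - C₂) / 2 / (A * (A + 2)) := by
    have hC : 0 < C₁ - C₂ := sub_pos.mpr h
    positivity
  have hlin : Tendsto (fun T : ℝ => (C₁ - C₂) / 2 / (A * (A + 2)) * T +
      (-M - quotientMinorantPrimitive C₁ C₂ A 0)) atTop atTop :=
    tendsto_atTop_add_const_right _ _ (tendsto_id.const_mul_atTop hslope)
  refine tendsto_atTop_mono' atTop ?_ hlin
  filter_upwards [eventually_ge_atTop 0] with T hT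
  have hint := (continuous_quotientMinorant C₁ C₂ hA).intervalIntegrable
    (μ := MeasureTheory.volume) 0 T
  have hFTC := intervalIntegral.integral_eq_sub_of_hasDerivAt
    (fun t _ => hasDerivAt_quotientMinorantPrimitive C₁ C₂ hA t) hint
  have hmono := intervalIntegral.integral_mono_on hT hint
    ((continuous_trig_quotient C₁ C₂ hA).intervalIntegrable 0 T)
    fun t _ => quotientMinorant_le h.le hA t
  linarith [hM T]

/-- The substitution `t = -log r` on an interval of positive reals. -/
theorem integral_comp_neg_log_div {f : ℝ → ℝ} (hf : Continuous f) {a b : ℝ}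
    (ha : 0 < a) (hb : 0 < b) :
    ∫ r in a..b, f (-Real.log r) / r =
      (∫ t in (0:ℝ)..-Real.log a, f t) - ∫ t in (0:ℝ)..-Real.log b, f t := by
  have hpos : ∀ r ∈ uIcc a b, r ≠ 0 := fun r hr => ((lt_min ha hb).trans_le hr.1).ne'
  have hderiv : ∀ r ∈ uIcc a b,
      HasDerivAt (fun x => -∫ t in (0:ℝ)..-Real.log x, f t) (f (-Real.log r) / r) r := by
    intro r hr
    have hcomp := ((hf.integral_hasStrictDerivAt 0 (-Real.log r)).hasDerivAt.comp r
      (Real.hasDerivAt_log (hpos r hr)).neg).neg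
    refine hcomp.congr_deriv ?_
    ring
  have hcont : ContinuousOn (fun r => f (-Real.log r) / r) (uIcc a b) :=
    (hf.comp_continuousOn (Real.continuousOn_log.mono hpos).neg).div continuousOn_id hpos
  rw [intervalIntegral.integral_eq_sub_of_hasDerivAt hderiv hcont.intervalIntegrable]
  ring

/-- For real constants `C₁ > C₂` there exists `A₀ ≥ 2` such that for every
`A ≥ A₀`, `∫₀^T (−C₁ sin t − C₂ cos t)/(A + sin t − cos t) dt → +∞` as `T → ∞`; in
particular (`t = −log r`) `∫_ε^{1/2} g(r)/r dr → +∞` as `ε → 0⁺`, where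
`g(r) = (−C₁ sin(−log r) − C₂ cos(−log r))/(A + sin(−log r) − cos(−log r))`. -/
theorem stmt_17 (C₁ C₂ : ℝ) (h : C₂ < C₁) :
    ∃ A₀ : ℝ, 2 ≤ A₀ ∧ ∀ A : ℝ, A₀ ≤ A →
      Tendsto
        (fun T => ∫ t in (0:ℝ)..T,
          (-C₁ * Real.sin t - C₂ * Real.cos t) / (A + Real.sin t - Real.cos t))
        atTop atTop ∧
      Tendsto
        (fun ε => ∫ r in ε..(1/2:ℝ),
          ((-C₁ * Real.sin (-Real.log r) - C₂ * Real.cos (-Real.log r)) /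
            (A + Real.sin (-Real.log r) - Real.cos (-Real.log r))) / r)
        (nhdsWithin (0:ℝ) (Ioi 0)) atTop := by
  refine ⟨2, le_rfl, fun A hA => ⟨tendsto_integral_trig_quotient h hA, ?_⟩⟩
  have hlog : Tendsto (fun ε : ℝ => -Real.log ε) (nhdsWithin (0:ℝ) (Ioi 0)) atTop :=
    tendsto_neg_atBot_atTop.comp Real.tendsto_log_nhdsGT_zero
  have hlim := tendsto_atTop_add_const_right _
    (-∫ t in (0:ℝ)..-Real.log (1 / 2),
      (-C₁ * Real.sin t - C₂ * Real.cos t) / (A + Real.sin t - Real.cos t))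
    ((tendsto_integral_trig_quotient h hA).comp hlog)
  refine hlim.congr' ?_
  filter_upwards [self_mem_nhdsWithin] with ε hε
  exact (integral_comp_neg_log_div (continuous_trig_quotient C₁ C₂ hA) hε
    (by norm_num)).symm
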